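/- arXiv:1509.09188 — 2 statements merged into one kernel-verified Lean document; each statement's English description precedes it below -/
import Mathlib

section
/- If Ψ > 4·k^{3/2}, then for all distinct i,j ∈ {1,…,k} the columns of the matrix B satisfy 1 − 3k/Ψ ≤ ⟨B_{:,i}, B_{:,i}⟩ ≤ 1 + 3k/Ψ and |⟨B_{:,i}, B_{:,j}⟩| ≤ 4·√(k/Ψ). -/
open Finset BigOperators Matrix

namespace SpectralClustering

variable {V : Type} [Fintype V] [DecidableEq V]

/-- Volume of a vertex set: the sum of the degrees of its vertices. -/
def vol (G : SimpleGraph V) [DecidableRel G.Adj] (S : Finset V) : ℕ :=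
  ∑ v ∈ S, G.degree v

/-- Number of edges between two (disjoint) vertex sets. -/
def cut (G : SimpleGraph V) [DecidableRel G.Adj] (S T : Finset V) : ℕ :=
  ∑ u ∈ S, (T.filter fun v => G.Adj u v).card

/-- Conductance `φ(S) = |E(S, V \ S)| / μ(S)`. -/
noncomputable def conductance (G : SimpleGraph V) [DecidableRel G.Adj] (S : Finset V) : ℝ :=
  (cut G S Sᶜ : ℝ) / (vol G S : ℝ)

/-- A `k`-way partition of the vertex set into nonempty blocks. -/
def IsKWayPartition {k : ℕ} (P : Fin k → Finset V) : Prop :=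
  (∀ i, (P i).Nonempty) ∧ (∀ i j, i ≠ j → Disjoint (P i) (P j)) ∧
    (∀ v : V, ∃ i, v ∈ P i)

/-- Maximum conductance over the blocks of a tuple of sets. -/
noncomputable def maxCond (G : SimpleGraph V) [DecidableRel G.Adj] {k : ℕ}
    (P : Fin k → Finset V) : ℝ :=
  ⨆ i, conductance G (P i)

/-- Average conductance of the blocks. -/
noncomputable def avgCond (G : SimpleGraph V) [DecidableRel G.Adj] {k : ℕ}
    (P : Fin k → Finset V) : ℝ :=
  (∑ i, conductance G (P i)) / (k : ℝ)

/-- `P` achieves `ρ̂_avr(k)`: it minimizes the maximum conductance among all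
`k`-way partitions, and among those it has minimal average conductance. -/
def AchievesRhoAvr (G : SimpleGraph V) [DecidableRel G.Adj] {k : ℕ}
    (P : Fin k → Finset V) : Prop :=
  IsKWayPartition P ∧
  (∀ Q : Fin k → Finset V, IsKWayPartition Q → maxCond G P ≤ maxCond G Q) ∧
  (∀ Q : Fin k → Finset V, IsKWayPartition Q → maxCond G Q = maxCond G P →
    avgCond G P ≤ avgCond G Q)

/-- Dot product of two vectors indexed by the vertices. -/
def dotV (x y : V → ℝ) : ℝ := ∑ v, x v * y v

/-- The normalized Laplacian `I - D^{-1/2} A D^{-1/2}`. -/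
noncomputable def normLap (G : SimpleGraph V) [DecidableRel G.Adj] : Matrix V V ℝ :=
  1 - Matrix.diagonal (fun v => (Real.sqrt (G.degree v))⁻¹) * G.adjMatrix ℝ *
      Matrix.diagonal (fun v => (Real.sqrt (G.degree v))⁻¹)

/-- `f` is an orthonormal family of eigenvectors of the normalized Laplacian of `G`
with (sorted) eigenvalues `lam`. -/
structure EigenData (G : SimpleGraph V) [DecidableRel G.Adj]
    (f : Fin (Fintype.card V) → V → ℝ) (lam : Fin (Fintype.card V) → ℝ) : Prop where
  eig : ∀ i, (normLap G).mulVec (f i) = lam i • f i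
  ortho : ∀ i j, dotV (f i) (f j) = if i = j then (1 : ℝ) else 0
  mono : Monotone lam

/-- The gap parameter `Ψ = λ_{k+1} / ρ̂_avr(k)`, where `ρ̂_avr(k)` is realized as the
average conductance of the fixed optimal partition `P`. -/
noncomputable def Psi (G : SimpleGraph V) [DecidableRel G.Adj]
    (lam : Fin (Fintype.card V) → ℝ) {k : ℕ} (P : Fin k → Finset V)
    (hkn : k < Fintype.card V) : ℝ :=
  lam ⟨k, hkn⟩ / avgCond G P

/-- The spectral embedding `F(u) = d_u^{-1/2} (f_1(u), …, f_k(u))`. -/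
noncomputable def Femb (G : SimpleGraph V) [DecidableRel G.Adj]
    (f : Fin (Fintype.card V) → V → ℝ) {k : ℕ} (hk : k ≤ Fintype.card V) (u : V) :
    Fin k → ℝ :=
  fun j => f (Fin.castLE hk j) u / Real.sqrt (G.degree u)

/-- `k`-means cost of a clustering of the (degree-weighted) spectral embedding:
`∑_i ∑_{u ∈ A_i} d_u ‖F(u) - c_i‖²`. -/
noncomputable def kmCost (G : SimpleGraph V) [DecidableRel G.Adj]
    (f : Fin (Fintype.card V) → V → ℝ) {k : ℕ} (hk : k ≤ Fintype.card V) {ℓ : ℕ}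
    (A : Fin ℓ → Finset V) (c : Fin ℓ → Fin k → ℝ) : ℝ :=
  ∑ i, ∑ u ∈ A i, (G.degree u : ℝ) * ∑ j, (Femb G f hk u j - c i j) ^ 2

/-- `Δ_ℓ(𝒳_V)`: the optimal `ℓ`-means cost of the spectral embedding multiset `𝒳_V`
(which contains `d_u` copies of `F(u)` for every vertex `u`). -/
noncomputable def kmOpt (G : SimpleGraph V) [DecidableRel G.Adj]
    (f : Fin (Fintype.card V) → V → ℝ) {k : ℕ} (hk : k ≤ Fintype.card V) (ℓ : ℕ) : ℝ :=
  sInf { r : ℝ | ∃ (A : Fin ℓ → Finset V) (c : Fin ℓ → Fin k → ℝ),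
    (∀ i j, i ≠ j → Disjoint (A i) (A j)) ∧ (∀ v : V, ∃ i, v ∈ A i) ∧
    r = kmCost G f hk A c }

/-- Normalized characteristic vector `ḡ_i = D^{1/2} χ_{P_i} / √μ(P_i)`. -/
noncomputable def gbar (G : SimpleGraph V) [DecidableRel G.Adj] {k : ℕ}
    (P : Fin k → Finset V) (i : Fin k) : V → ℝ :=
  fun v => (if v ∈ P i then Real.sqrt (G.degree v) else 0) / Real.sqrt (vol G (P i))

/-- Coefficients `α_j^{(i)} = ⟨ḡ_i, f_j⟩` of `ḡ_i` in the eigenbasis. -/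
noncomputable def alpha (G : SimpleGraph V) [DecidableRel G.Adj] {k : ℕ}
    (P : Fin k → Finset V) (f : Fin (Fintype.card V) → V → ℝ)
    (i : Fin k) (j : Fin (Fintype.card V)) : ℝ :=
  dotV (gbar G P i) (f j)

/-- Projection `f̂_i = ∑_{j=1}^k α_j^{(i)} f_j` of `ḡ_i` onto the first `k` eigenvectors. -/
noncomputable def fhat (G : SimpleGraph V) [DecidableRel G.Adj] {k : ℕ}
    (P : Fin k → Finset V) (f : Fin (Fintype.card V) → V → ℝ) (i : Fin k) : V → ℝ :=
  fun v => ∑ j : Fin (Fintype.card V),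
    if (j : ℕ) < k then alpha G P f i j * f j v else 0

/-- Estimation center `p^{(i)} = μ(P_i)^{-1/2} (β_i^{(1)}, …, β_i^{(k)})`;
here `beta i j` denotes `β_j^{(i)}`. -/
noncomputable def estCenter (G : SimpleGraph V) [DecidableRel G.Adj] {k : ℕ}
    (P : Fin k → Finset V) (beta : Fin k → Fin k → ℝ) (i : Fin k) : Fin k → ℝ :=
  fun j => beta j i / Real.sqrt (vol G (P i))

section Spectral

variable (G : SimpleGraph V) [DecidableRel G.Adj]

lemma transpose_normLap : (normLap G)ᵀ = normLap G := by
  simp [normLap, Matrix.transpose_mul, Matrix.mul_assoc]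

/-- The quadratic form of the normalized Laplacian at `D^{1/2} y`. -/
lemma dotV_normLap_mulVec (hd : ∀ v : V, 0 < G.degree v) (y : V → ℝ) :
    dotV (fun v => Real.sqrt (G.degree v) * y v)
        ((normLap G).mulVec fun v => Real.sqrt (G.degree v) * y v) =
      ∑ u, ∑ v, if G.Adj u v then y u ^ 2 - y u * y v else 0 := by
  have hs : ∀ v, Real.sqrt (G.degree v) ≠ 0 := fun v =>
    (Real.sqrt_pos.2 (by exact_mod_cast hd v)).ne'
  unfold dotV normLap
  refine Finset.sum_congr rfl fun u _ => ?_
  have hentry : ((1 - Matrix.diagonal (fun v => (Real.sqrt (G.degree v))⁻¹) * G.adjMatrix ℝ *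
      Matrix.diagonal (fun v => (Real.sqrt (G.degree v))⁻¹)).mulVec
        fun v => Real.sqrt (G.degree v) * y v) u =
      Real.sqrt (G.degree u) * y u -
        (Real.sqrt (G.degree u))⁻¹ * ∑ v, if G.Adj u v then y v else 0 := by
    rw [Matrix.sub_mulVec, Matrix.one_mulVec, Pi.sub_apply, Finset.mul_sum]
    congr 1
    simp only [Matrix.mulVec, dotProduct, Matrix.mul_diagonal, Matrix.diagonal_mul,
      SimpleGraph.adjMatrix_apply]
    refine Finset.sum_congr rfl fun v _ => ?_
    have := hs v
    split_ifs <;> field_simp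
    simp
  have hdeg : (G.degree u : ℝ) = ∑ v, if G.Adj u v then (1 : ℝ) else 0 := by
    rw [← SimpleGraph.card_neighborFinset_eq_degree, SimpleGraph.neighborFinset_eq_filter]
    simp
  have hsq := Real.mul_self_sqrt (Nat.cast_nonneg (α := ℝ) (G.degree u))
  have hsum : (∑ v, if G.Adj u v then y u ^ 2 - y u * y v else 0) =
      (G.degree u : ℝ) * y u ^ 2 - y u * ∑ v, if G.Adj u v then y v else 0 := by
    rw [hdeg, Finset.mul_sum, Finset.sum_mul, ← Finset.sum_sub_distrib]
    refine Finset.sum_congr rfl fun v _ => ?_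
    split_ifs <;> ring
  rw [hentry, hsum]
  linear_combination y u ^ 2 * hsq -
    (y u * ∑ v, if G.Adj u v then y v else 0) * mul_inv_cancel₀ (hs u)

lemma dotV_normLap_mulVec_nonneg (hd : ∀ v : V, 0 < G.degree v) (x : V → ℝ) :
    0 ≤ dotV x ((normLap G).mulVec x) := by
  obtain ⟨y, rfl⟩ : ∃ y : V → ℝ, x = fun v => Real.sqrt (G.degree v) * y v := by
    refine ⟨fun v => x v / Real.sqrt (G.degree v), funext fun v => ?_⟩
    have := (Real.sqrt_pos.2 (by exact_mod_cast hd v : (0 : ℝ) < G.degree v)).ne'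
    field_simp
  rw [dotV_normLap_mulVec G hd]
  have hswap : (∑ u, ∑ v, if G.Adj u v then y u ^ 2 - y u * y v else 0) =
      ∑ u, ∑ v, if G.Adj u v then y v ^ 2 - y u * y v else 0 := by
    rw [Finset.sum_comm]
    refine Finset.sum_congr rfl fun u _ => Finset.sum_congr rfl fun v _ => ?_
    simp only [G.adj_comm v u, mul_comm (y v)]
  have hadd : 0 ≤ (∑ u, ∑ v, if G.Adj u v then y u ^ 2 - y u * y v else 0) +
      ∑ u, ∑ v, if G.Adj u v then y v ^ 2 - y u * y v else 0 := by
    simp only [← Finset.sum_add_distrib]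
    refine Finset.sum_nonneg fun u _ => Finset.sum_nonneg fun v _ => ?_
    split_ifs
    · nlinarith [sq_nonneg (y u - y v)]
    · simp
  linarith

lemma conductance_nonneg (S : Finset V) : 0 ≤ conductance G S := by
  unfold conductance; positivity

/-- The Rayleigh quotient of a normalized indicator vector is the conductance. -/
lemma dotV_gbar_normLap (hd : ∀ v : V, 0 < G.degree v) {k : ℕ} (P : Fin k → Finset V)
    (i : Fin k) :
    dotV (gbar G P i) ((normLap G).mulVec (gbar G P i)) = conductance G (P i) := by
  have hg : gbar G P i = fun v => Real.sqrt (G.degree v) *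
      ((if v ∈ P i then 1 else 0) / Real.sqrt (vol G (P i))) := by
    funext v
    unfold gbar
    split_ifs <;> ring
  have hsq := Real.mul_self_sqrt (Nat.cast_nonneg (α := ℝ) (vol G (P i)))
  have hcut : (cut G (P i) (P i)ᶜ : ℝ) = ∑ u, ∑ v,
      if u ∈ P i ∧ v ∉ P i ∧ G.Adj u v then (1 : ℝ) else 0 := by
    unfold cut
    push_cast
    rw [← Finset.sum_filter_add_sum_filter_not Finset.univ (· ∈ P i)]
    rw [Finset.sum_eq_zero (s := Finset.univ.filter (· ∉ P i)), add_zero]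
    · rw [Finset.filter_univ_mem]
      refine Finset.sum_congr rfl fun u hu => ?_
      rw [Finset.card_filter]
      push_cast
      rw [← Finset.sum_subset (Finset.subset_univ (P i)ᶜ)]
      · refine Finset.sum_congr rfl fun v hv => ?_
        rw [Finset.mem_compl] at hv
        simp [hu, hv]
      · intro v _ hv
        simp_all
    · intro u hu
      simp_all
  rw [hg, dotV_normLap_mulVec G hd, conductance, hcut, Finset.sum_div]
  refine Finset.sum_congr rfl fun u _ => ?_
  rw [Finset.sum_div]
  refine Finset.sum_congr rfl fun v _ => ?_
  rw [div_pow, div_mul_div_comm, hsq, sq (Real.sqrt _), hsq]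
  by_cases hu : u ∈ P i <;> by_cases hv : v ∈ P i <;> by_cases ha : G.Adj u v <;>
    simp [hu, hv, ha]

lemma dotV_gbar_gbar (hd : ∀ v : V, 0 < G.degree v) {k : ℕ} {P : Fin k → Finset V}
    (hP : IsKWayPartition P) (i j : Fin k) :
    dotV (gbar G P i) (gbar G P j) = if i = j then 1 else 0 := by
  split_ifs with hij
  · subst hij
    have hv : (0 : ℝ) < vol G (P i) := by
      exact_mod_cast Finset.sum_pos (fun v _ => hd v) (hP.1 i)
    have hsq := Real.mul_self_sqrt hv.le
    have hvol : (vol G (P i) : ℝ) = ∑ v, if v ∈ P i then (G.degree v : ℝ) else 0 := by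
      simp [vol]
    have : dotV (gbar G P i) (gbar G P i) = (vol G (P i) : ℝ) / vol G (P i) := by
      nth_rewrite 1 [hvol]
      unfold dotV gbar
      rw [Finset.sum_div]
      refine Finset.sum_congr rfl fun v _ => ?_
      rw [div_mul_div_comm, hsq]
      split_ifs <;> simp
    rw [this, div_self hv.ne']
  · refine Finset.sum_eq_zero fun v _ => ?_
    have : v ∈ P i → v ∉ P j := fun hi => Finset.disjoint_left.1 (hP.2.1 i j hij) hi
    unfold gbar
    by_cases hi : v ∈ P i
    · simp [this hi]
    · simp [hi]

variable {G} {f : Fin (Fintype.card V) → V → ℝ} {lam : Fin (Fintype.card V) → ℝ}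

lemma EigenData.parseval (hf : EigenData G f lam) (x y : V → ℝ) :
    dotV x y = ∑ m, dotV x (f m) * dotV y (f m) := by
  have h1 : Matrix.of f * (Matrix.of f)ᵀ = 1 := by
    ext i j
    rw [Matrix.one_apply, ← hf.ortho i j]
    rfl
  have h2 : (Matrix.of f)ᵀ * Matrix.of f = 1 :=
    (Matrix.mul_eq_one_comm_of_equiv (Fintype.equivFin V).symm).1 h1
  have h3 : ∀ z : V → ℝ, (Matrix.of f).mulVec z = fun m => dotV z (f m) := fun z => by
    funext m
    exact dotProduct_comm _ _
  calc dotV x y = x ⬝ᵥ ((Matrix.of f)ᵀ * Matrix.of f).mulVec y := by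
        rw [h2, Matrix.one_mulVec]; rfl
    _ = (Matrix.of f).mulVec x ⬝ᵥ (Matrix.of f).mulVec y := by
        rw [← Matrix.mulVec_mulVec, Matrix.dotProduct_mulVec, Matrix.vecMul_transpose]
    _ = _ := by rw [h3, h3]; rfl

lemma EigenData.dotV_normLap (hf : EigenData G f lam) (x : V → ℝ) :
    dotV x ((normLap G).mulVec x) = ∑ m, lam m * dotV x (f m) ^ 2 := by
  rw [hf.parseval]
  refine Finset.sum_congr rfl fun m _ => ?_
  have : dotV ((normLap G).mulVec x) (f m) = lam m * dotV x (f m) := by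
    calc dotV ((normLap G).mulVec x) (f m) = x ⬝ᵥ (normLap G).mulVec (f m) := by
          rw [Matrix.dotProduct_mulVec, ← Matrix.mulVec_transpose, transpose_normLap]; rfl
      _ = _ := by rw [hf.eig, dotProduct_smul]; rfl
  rw [this]
  ring

lemma EigenData.lam_nonneg (hf : EigenData G f lam) (hd : ∀ v : V, 0 < G.degree v)
    (m : Fin (Fintype.card V)) : 0 ≤ lam m := by
  have h := dotV_normLap_mulVec_nonneg G hd (f m)
  rw [hf.dotV_normLap] at h
  simpa [hf.ortho] using h

/-- The mass of `ḡ_i` outside the first `k` eigenvectors is controlled by `φ(P_i)`. -/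
lemma EigenData.lam_mul_tail_le (hf : EigenData G f lam) (hd : ∀ v : V, 0 < G.degree v)
    {k : ℕ} (hkn : k < Fintype.card V) (P : Fin k → Finset V) (i : Fin k) :
    lam ⟨k, hkn⟩ * ∑ m with k ≤ m.val, alpha G P f i m ^ 2 ≤ conductance G (P i) := by
  rw [← dotV_gbar_normLap G hd, hf.dotV_normLap, Finset.mul_sum]
  refine (Finset.sum_le_sum fun m hm => ?_).trans
    (Finset.sum_le_sum_of_subset_of_nonneg (Finset.filter_subset _ _) fun m _ _ =>
      mul_nonneg (hf.lam_nonneg hd m) (sq_nonneg _))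
  exact mul_le_mul_of_nonneg_right (hf.mono (Finset.mem_filter.1 hm).2) (sq_nonneg _)

/-- Pairing `f_i = ∑ β_j f̂_j` with an eigenvector of index below `k`. -/
lemma EigenData.sum_mul_alpha (hf : EigenData G f lam) {k : ℕ} {P : Fin k → Finset V}
    {b : Fin k → ℝ} {a : Fin (Fintype.card V)}
    (hb : f a = fun v => ∑ j : Fin k, b j * fhat G P f j v)
    {m : Fin (Fintype.card V)} (hm : m.val < k) :
    ∑ j, b j * alpha G P f j m = if a = m then 1 else 0 := by
  have hfhat : ∀ j, dotV (fhat G P f j) (f m) = alpha G P f j m := fun j => by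
    have : dotV (fhat G P f j) (f m) =
        ∑ l, if l.val < k then alpha G P f j l * dotV (f l) (f m) else 0 := by
      unfold dotV fhat
      simp only [Finset.sum_mul]
      rw [Finset.sum_comm]
      refine Finset.sum_congr rfl fun l _ => ?_
      split_ifs
      · rw [Finset.mul_sum]
        exact Finset.sum_congr rfl fun v _ => by ring
      · simp
    rw [this, Finset.sum_eq_single m]
    · simp [hm, hf.ortho]
    · intro l _ hl
      simp [hf.ortho, hl]
    · simp
  rw [← hf.ortho a m, hb]
  simp only [← hfhat, dotV, Finset.sum_mul, Finset.mul_sum]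
  rw [Finset.sum_comm]
  exact Finset.sum_congr rfl fun v _ => Finset.sum_congr rfl fun j _ => by ring

/-- Expansion of `∑ b_j ḡ_j` in the eigenbasis preserves inner products. -/
lemma EigenData.sum_mul_eq_sum_coeff (hf : EigenData G f lam) (hd : ∀ v : V, 0 < G.degree v)
    {k : ℕ} {P : Fin k → Finset V} (hP : IsKWayPartition P) (b c : Fin k → ℝ) :
    ∑ l, b l * c l =
      ∑ m, (∑ j, b j * alpha G P f j m) * ∑ j, c j * alpha G P f j m := by
  have h : ∀ i j, ∑ m, alpha G P f i m * alpha G P f j m = if i = j then 1 else 0 :=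
    fun i j => by rw [← dotV_gbar_gbar G hd hP, hf.parseval]; rfl
  calc ∑ l, b l * c l = ∑ i, ∑ j, b i * c j * ∑ m, alpha G P f i m * alpha G P f j m := by
        simp [h]
    _ = _ := by
        simp only [Finset.sum_mul_sum]
        rw [Finset.sum_comm (s := Finset.univ (α := Fin (Fintype.card V)))]
        refine Finset.sum_congr rfl fun i _ => ?_
        rw [Finset.sum_comm]
        refine Finset.sum_congr rfl fun j _ => ?_
        rw [Finset.mul_sum]
        exact Finset.sum_congr rfl fun m _ => by ring

end Spectral

theorem columns_of_B_almost_orthonormal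
    {V : Type} [Fintype V] [DecidableEq V] (G : SimpleGraph V) [DecidableRel G.Adj]
    (hd : ∀ v : V, 0 < G.degree v)
    {k : ℕ} (hkn : k < Fintype.card V)
    (f : Fin (Fintype.card V) → V → ℝ) (lam : Fin (Fintype.card V) → ℝ)
    (hf : EigenData G f lam)
    (P : Fin k → Finset V) (hP : AchievesRhoAvr G P)
    (beta : Fin k → Fin k → ℝ)
    (hbeta : ∀ i : Fin k,
      f (Fin.castLE hkn.le i) = fun v => ∑ j : Fin k, beta i j * fhat G P f j v)
    (hPsi : Psi G lam P hkn > 4 * Real.sqrt ((k : ℝ) ^ 3)) :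
    (∀ i : Fin k,
        1 - 3 * (k : ℝ) / Psi G lam P hkn ≤ ∑ l : Fin k, beta i l * beta i l ∧
          ∑ l : Fin k, beta i l * beta i l ≤ 1 + 3 * (k : ℝ) / Psi G lam P hkn) ∧
      ∀ i j : Fin k, i ≠ j →
        |∑ l : Fin k, beta i l * beta j l| ≤
          4 * Real.sqrt ((k : ℝ) / Psi G lam P hkn) := by
  have hlam := hf.lam_nonneg hd ⟨k, hkn⟩
  have hΨ : 0 < Psi G lam P hkn := lt_of_le_of_lt (by positivity) hPsi
  have hsum0 : 0 ≤ ∑ i, conductance G (P i) :=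
    Finset.sum_nonneg fun i _ => conductance_nonneg G _
  have hlampos : 0 < lam ⟨k, hkn⟩ := by
    refine hlam.lt_of_ne fun h => ?_
    rw [Psi, ← h, zero_div] at hΨ
    exact hΨ.false
  rcases Nat.eq_zero_or_pos k with rfl | hk
  · exact ⟨fun i => i.elim0, fun i => i.elim0⟩
  have hk1 : (1 : ℝ) ≤ k := by exact_mod_cast hk
  set ε : ℝ := (k : ℝ) / Psi G lam P hkn with hε
  have hε0 : 0 ≤ ε := by positivity
  have hεlam : lam ⟨k, hkn⟩ * ε = ∑ i, conductance G (P i) := by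
    rw [hε, Psi, avgCond]
    field_simp
  have hε4 : ε ≤ 1 / 4 := by
    have h1 : (k : ℝ) ≤ Real.sqrt ((k : ℝ) ^ 3) := by
      apply Real.le_sqrt_of_sq_le
      nlinarith [sq_nonneg (k : ℝ)]
    rw [hε, div_le_iff₀ hΨ]
    linarith
  have htail : ∑ j, ∑ m with k ≤ m.val, alpha G P f j m ^ 2 ≤ ε := by
    refine le_of_mul_le_mul_left ?_ hlampos
    rw [hεlam, Finset.mul_sum]
    exact Finset.sum_le_sum fun j _ => hf.lam_mul_tail_le hd hkn P j
  let c : Fin k → Fin (Fintype.card V) → ℝ := fun i m => ∑ j, beta i j * alpha G P f j m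
  have hgram : ∀ i j, ∑ l, beta i l * beta j l =
      (if i = j then 1 else 0) + ∑ m with k ≤ m.val, c i m * c j m := fun i j => by
    rw [hf.sum_mul_eq_sum_coeff hd hP.1,
      ← Finset.sum_filter_add_sum_filter_not Finset.univ
        (fun m : Fin (Fintype.card V) => m.val < k)]
    simp only [not_lt]
    congr 1
    rw [Finset.sum_congr rfl fun m hm => by
      rw [hf.sum_mul_alpha (hbeta i) (Finset.mem_filter.1 hm).2,
        hf.sum_mul_alpha (hbeta j) (Finset.mem_filter.1 hm).2]]
    rw [Finset.sum_eq_single (Fin.castLE hkn.le i)]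
    · simp [Fin.ext_iff, eq_comm]
    · intro m _ hm
      simp [hm.symm]
    · simp
  have hres : ∀ i, ∑ m with k ≤ m.val, c i m ^ 2 ≤ ε * ∑ l, beta i l * beta i l := fun i => by
    calc ∑ m with k ≤ m.val, c i m ^ 2
        ≤ ∑ m with k ≤ m.val, (∑ j, beta i j ^ 2) * ∑ j, alpha G P f j m ^ 2 :=
          Finset.sum_le_sum fun m _ => Finset.sum_mul_sq_le_sq_mul_sq _ _ _
      _ = (∑ j, ∑ m with k ≤ m.val, alpha G P f j m ^ 2) * ∑ l, beta i l * beta i l := by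
          rw [← Finset.mul_sum, Finset.sum_comm, mul_comm]
          simp only [sq]
      _ ≤ _ := mul_le_mul_of_nonneg_right htail
          (Finset.sum_nonneg fun l _ => mul_self_nonneg _)
  have hdiag : ∀ i, ∑ l, beta i l * beta i l = 1 + ∑ m with k ≤ m.val, c i m ^ 2 := fun i => by
    rw [hgram i i, if_pos rfl]
    simp only [sq]
  have hres0 : ∀ i, 0 ≤ ∑ m with k ≤ m.val, c i m ^ 2 := fun i =>
    Finset.sum_nonneg fun m _ => sq_nonneg _
  have hres2 : ∀ i, ∑ m with k ≤ m.val, c i m ^ 2 ≤ 2 * ε := fun i => by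
    have h := hres i
    rw [hdiag i] at h
    nlinarith [hres0 i]
  have h3 : 3 * (k : ℝ) / Psi G lam P hkn = 3 * ε := by rw [hε]; ring
  refine ⟨fun i => ?_, fun i j hij => ?_⟩
  · rw [h3, hdiag i]
    constructor <;> linarith [hres0 i, hres2 i]
  · rw [hgram i j, if_neg hij, zero_add]
    have hcs := Finset.sum_mul_sq_le_sq_mul_sq
      (Finset.univ.filter fun m : Fin (Fintype.card V) => k ≤ m.val) (c i) (c j)
    have hε_sqrt : ε ≤ Real.sqrt ε := Real.le_sqrt_of_sq_le (by nlinarith)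
    refine (abs_le_of_sq_le_sq (b := 2 * ε) ?_ (by positivity)).trans (by linarith)
    calc _ ≤ _ := hcs
      _ ≤ (2 * ε) * (2 * ε) := mul_le_mul (hres2 i) (hres2 j) (hres0 j) (by positivity)
      _ = (2 * ε) ^ 2 := by ring

end SpectralClustering
end

section
/- If Ψ > 25·k^3, then the columns B_{:,1},…,B_{:,k} of the matrix B are linearly independent. -/
open Finset BigOperators Matrix

namespace SpectralClustering

variable {V : Type} [Fintype V] [DecidableEq V]

theorem columns_of_B_linearly_independent
    {V : Type} [Fintype V] [DecidableEq V] (G : SimpleGraph V) [DecidableRel G.Adj]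
    (hd : ∀ v : V, 0 < G.degree v)
    {k : ℕ} (hkn : k < Fintype.card V)
    (f : Fin (Fintype.card V) → V → ℝ) (lam : Fin (Fintype.card V) → ℝ)
    (hf : EigenData G f lam)
    (P : Fin k → Finset V) (hP : AchievesRhoAvr G P)
    (beta : Fin k → Fin k → ℝ)
    (hbeta : ∀ i : Fin k,
      f (Fin.castLE hkn.le i) = fun v => ∑ j : Fin k, beta i j * fhat G P f j v)
    (hPsi : Psi G lam P hkn > 25 * (k : ℝ) ^ 3) :
    LinearIndependent ℝ beta := by
  rw [Fintype.linearIndependent_iff]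
  intro c hc i
  have hfc : ∀ v, ∑ j, c j * f (Fin.castLE hkn.le j) v = 0 := by
    intro v
    have hcoord : ∀ l, ∑ j, c j * beta j l = 0 := fun l => by
      simpa using congrFun hc l
    calc ∑ j, c j * f (Fin.castLE hkn.le j) v
        = ∑ j, ∑ l, c j * beta j l * fhat G P f l v := by
          refine Finset.sum_congr rfl fun j _ => ?_
          rw [congrFun (hbeta j) v, Finset.mul_sum]
          exact Finset.sum_congr rfl fun l _ => (mul_assoc _ _ _).symm
      _ = 0 := by
          rw [Finset.sum_comm]
          refine Finset.sum_eq_zero fun l _ => ?_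
          rw [← Finset.sum_mul, hcoord, zero_mul]
  calc c i = ∑ j, c j * dotV (f (Fin.castLE hkn.le j)) (f (Fin.castLE hkn.le i)) := by
        simp [hf.ortho, Fin.castLE_inj]
    _ = ∑ v, (∑ j, c j * f (Fin.castLE hkn.le j) v) * f (Fin.castLE hkn.le i) v := by
        simp only [dotV, Finset.mul_sum, Finset.sum_mul, mul_assoc]
        exact Finset.sum_comm
    _ = 0 := by simp [hfc]

end SpectralClustering
end
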